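/- Let n ≥ 1 and let M be a positive C² function on ℝⁿ. Let E ⊂ ℝⁿ be closed, t > 0, f ∈ L²(ℝⁿ,M) supported in E, and let u ∈ H¹(ℝⁿ,M) satisfy ∫ u v M dx + t ∫ ∇u·∇v M dx = ∫ f v M dx for all v ∈ H¹(ℝⁿ,M). Then for every α > 0 and every bounded nonnegative Lipschitz function ζ on ℝⁿ vanishing on E, one has ∫_{ℝⁿ} (e^{α ζ(x)} - 1)² |u(x)|² M(x) dx ≤ α² t ∫_{ℝⁿ} |u(x)|² |∇ζ(x)|² e^{2 α ζ(x)} M(x) dx. -/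

import Mathlib

open MeasureTheory Filter Real Set RealInnerProductSpace

/-- Membership in the weighted Sobolev space `H¹(ℝⁿ, M)`: `f` is differentiable and both
`f` and its gradient are square integrable against the measure `M(x) dx`. -/
def MemH1 {n : ℕ} (M f : EuclideanSpace ℝ (Fin n) → ℝ) : Prop :=
  Differentiable ℝ f ∧ Integrable (fun x => f x ^ 2 * M x) ∧
    Integrable (fun x => ‖gradient f x‖ ^ 2 * M x)

/-- `u` is a weak solution of `(I + tL)u = f`, where `L = -Δ - ∇ ln M · ∇`. -/
def IsWeakSolution {n : ℕ} (M : EuclideanSpace ℝ (Fin n) → ℝ) (t : ℝ)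
    (f u : EuclideanSpace ℝ (Fin n) → ℝ) : Prop :=
  MemH1 M u ∧ ∀ v : EuclideanSpace ℝ (Fin n) → ℝ, MemH1 M v →
    (∫ x, u x * v x * M x) + t * (∫ x, ⟪gradient u x, gradient v x⟫ * M x)
      = ∫ x, f x * v x * M x

set_option maxHeartbeats 800000

/-- Mollification step: a bounded Lipschitz function is a limit of differentiable ones. -/
lemma lip_approx {n : ℕ} (ζ : EuclideanSpace ℝ (Fin n) → ℝ) (K : NNReal) (C : ℝ)
    (hζ : LipschitzWith K ζ) (hC : ∀ x, ζ x ≤ C) (h0 : ∀ x, 0 ≤ ζ x) :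
    ∃ Z : ℕ → EuclideanSpace ℝ (Fin n) → ℝ, (∀ k, Differentiable ℝ (Z k)) ∧
      (∀ k x, 0 ≤ Z k x) ∧ (∀ k x, Z k x ≤ C) ∧ (∀ k x, ‖gradient (Z k) x‖ ≤ K) ∧
      (∀ x, Tendsto (fun k => Z k x) atTop (nhds (ζ x))) ∧
      (∀ᵐ x, Tendsto (fun k => gradient (Z k) x) atTop (nhds (gradient ζ x))) := by
  have hr : ∀ k : ℕ, (0:ℝ) < 1 / ((k:ℝ) + 1) := fun k => by positivity
  let φ : ℕ → ContDiffBump (0 : EuclideanSpace ℝ (Fin n)) := fun k =>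
    ⟨1 / ((k:ℝ) + 1), 2 * (1 / ((k:ℝ) + 1)), hr k, by linarith [hr k]⟩
  have hφ : Tendsto (fun k => (φ k).rOut) atTop (nhds 0) := by
    have := (tendsto_one_div_add_atTop_nhds_zero_nat (𝕜 := ℝ)).const_mul 2
    simpa [φ] using this
  have hφint : ∀ k, Integrable ((φ k).normed volume) := fun k => (φ k).integrable_normed
  have hφ1 : ∀ k, ∫ y, (φ k).normed volume y = 1 := fun k => (φ k).integral_normed
  have hφ0 : ∀ k y, 0 ≤ (φ k).normed volume y := fun k y => (φ k).nonneg_normed y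
  have hcont := hζ.continuous
  have hmeas' : Measurable (fderiv ℝ ζ) := measurable_fderiv ℝ ζ
  have hnorm : ∀ x, ‖fderiv ℝ ζ x‖ ≤ K := fun x => norm_fderiv_le_of_lipschitz ℝ hζ
  let Z : ℕ → EuclideanSpace ℝ (Fin n) → ℝ := fun k x =>
    ∫ y, (φ k).normed volume y • ζ (x - y)
  have hconvInt : ∀ k x, Integrable (fun y => (φ k).normed volume y • ζ (x - y)) := by
    intro k x
    refine Integrable.mono' ((hφint k).mul_const C) ?_ ?_
    · exact ((φ k).continuous_normed.smul (hcont.comp (by fun_prop))).aestronglyMeasurable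
    · refine Eventually.of_forall fun y => ?_
      rw [norm_smul, Real.norm_of_nonneg (hφ0 k y), Real.norm_of_nonneg (h0 _)]
      exact mul_le_mul_of_nonneg_left (hC _) (hφ0 k y)
  have hder : ∀ k x, HasFDerivAt (Z k)
      (∫ y, (φ k).normed volume y • fderiv ℝ ζ (x - y)) x := by
    intro k x
    refine (hasFDerivAt_integral_of_dominated_loc_of_lip'
      (bound := fun y => (φ k).normed volume y * K) (s := univ) univ_mem
      (fun x' _ => (hconvInt k x').aestronglyMeasurable) (hconvInt k x) ?_ ?_ ?_ ?_).2
    · exact ((φ k).continuous_normed.measurable.smul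
        (hmeas'.comp (by fun_prop))).aestronglyMeasurable
    · refine Eventually.of_forall fun y x' _ => ?_
      rw [← smul_sub, norm_smul, Real.norm_of_nonneg (hφ0 k y), mul_assoc]
      refine mul_le_mul_of_nonneg_left ?_ (hφ0 k y)
      have := hζ.norm_sub_le (x' - y) (x - y)
      simpa using this
    · exact (hφint k).mul_const _
    · have h1 : ∀ᵐ z, DifferentiableAt ℝ ζ z := hζ.ae_differentiableAt
      have h2 : ∀ᵐ y, DifferentiableAt ℝ ζ (x - y) :=
        (quasiMeasurePreserving_sub_left volume x).ae h1
      filter_upwards [h2] with y hy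
      have h3 : HasFDerivAt (fun x' => ζ (x' - y)) (fderiv ℝ ζ (x - y)) x :=
        (hasFDerivAt_comp_sub y).2 hy.hasFDerivAt
      exact h3.const_smul ((φ k).normed volume y)
  have hgr : ∀ k x, gradient (Z k) x = (InnerProductSpace.toDual ℝ _).symm
      (∫ y, (φ k).normed volume y • fderiv ℝ ζ (x - y)) := by
    intro k x
    rw [gradient, (hder k x).fderiv]
  refine ⟨Z, fun k x => (hder k x).differentiableAt, ?_, ?_, ?_, ?_, ?_⟩
  · intro k x
    exact integral_nonneg fun y => smul_nonneg (hφ0 k y) (h0 _)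
  · intro k x
    calc Z k x ≤ ∫ y, (φ k).normed volume y * C := by
          refine integral_mono (hconvInt k x) ((hφint k).mul_const C) fun y => ?_
          exact mul_le_mul_of_nonneg_left (hC _) (hφ0 k y)
      _ = C := by rw [integral_mul_const, hφ1, one_mul]
  · intro k x
    rw [hgr, LinearIsometryEquiv.norm_map]
    calc _ ≤ ∫ y, (φ k).normed volume y * (K:ℝ) := by
          refine norm_integral_le_of_norm_le ((hφint k).mul_const _) ?_
          refine Eventually.of_forall fun y => ?_
          rw [norm_smul, Real.norm_of_nonneg (hφ0 k y)]
          exact mul_le_mul_of_nonneg_left (hnorm _) (hφ0 k y)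
      _ = K := by rw [integral_mul_const, hφ1, one_mul]
  · intro x
    exact ContDiffBump.convolution_tendsto_right_of_continuous (μ := volume) hφ hcont x
  · have hloc : LocallyIntegrable (fderiv ℝ ζ) volume := by
      have hcst : LocallyIntegrable (fun _ : EuclideanSpace ℝ (Fin n) => (K:ℝ)) volume :=
        continuous_const.locallyIntegrable
      refine hcst.mono hmeas'.aestronglyMeasurable (Eventually.of_forall fun x => ?_)
      exact (hnorm x).trans (le_abs_self _)
    have := ContDiffBump.ae_convolution_tendsto_right_of_locallyIntegrable (μ := volume)
      (K := 2) hφ (Eventually.of_forall fun k => le_refl _) hloc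
    filter_upwards [this] with x hx
    simp_rw [hgr]
    exact ((InnerProductSpace.toDual ℝ _).symm.continuous.tendsto _).comp hx

lemma measurable_gradient_aux {n : ℕ} (g : EuclideanSpace ℝ (Fin n) → ℝ) :
    Measurable (gradient g) :=
  (InnerProductSpace.toDual ℝ _).symm.continuous.measurable.comp (measurable_fderiv ℝ g)

/-- The gradient of the test function. -/
lemma hasGradientAt_test {n : ℕ} (u z : EuclideanSpace ℝ (Fin n) → ℝ) (α : ℝ)
    (x : EuclideanSpace ℝ (Fin n)) (hu : DifferentiableAt ℝ u x) (hz : DifferentiableAt ℝ z x) :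
    HasGradientAt (fun x => u x * (Real.exp (α * z x) - 1) ^ 2)
      ((Real.exp (α * z x) - 1) ^ 2 • gradient u x +
        (2 * u x * (Real.exp (α * z x) - 1) * α * Real.exp (α * z x)) • gradient z x) x := by
  rw [hasGradientAt_iff_hasFDerivAt]
  have h1 := hu.hasFDerivAt
  have h2 := (((hz.hasFDerivAt.const_mul α).exp.sub_const 1).pow 2)
  refine (h1.fun_mul h2).congr_fderiv ?_
  ext y
  simp
  ring

/-- Exponential Caccioppoli-type estimate: if `f` is supported in the closed set `E` and
`u` solves `(I + tL)u = f` weakly, then for every `α > 0` and every bounded nonnegative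
Lipschitz `ζ` vanishing on `E`,
`∫ (e^{αζ} - 1)² u² M ≤ α² t ∫ u² |∇ζ|² e^{2αζ} M`. -/
theorem caccioppoli_exp {n : ℕ} (hn : 1 ≤ n)
    (M : EuclideanSpace ℝ (Fin n) → ℝ)
    (hMpos : ∀ x, 0 < M x) (hMreg : ContDiff ℝ 2 M)
    (E : Set (EuclideanSpace ℝ (Fin n))) (hE : IsClosed E)
    (t : ℝ) (ht : 0 < t)
    (f : EuclideanSpace ℝ (Fin n) → ℝ)
    (hfmeas : AEStronglyMeasurable f volume)
    (hfL2 : Integrable (fun x => f x ^ 2 * M x))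
    (hsupp : Function.support f ⊆ E)
    (u : EuclideanSpace ℝ (Fin n) → ℝ) (hu : IsWeakSolution M t f u)
    (α : ℝ) (hα : 0 < α)
    (ζ : EuclideanSpace ℝ (Fin n) → ℝ) (K : NNReal)
    (hζlip : LipschitzWith K ζ) (hζbdd : ∃ C, ∀ x, ζ x ≤ C)
    (hζnonneg : ∀ x, 0 ≤ ζ x) (hζE : ∀ x ∈ E, ζ x = 0) :
    (∫ x, (Real.exp (α * ζ x) - 1) ^ 2 * u x ^ 2 * M x)
      ≤ α ^ 2 * t * ∫ x, u x ^ 2 * ‖gradient ζ x‖ ^ 2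
          * Real.exp (2 * α * ζ x) * M x := by
  obtain ⟨C, hC⟩ := hζbdd
  obtain ⟨Z, hZd, hZ0, hZC, hZg, hZt, hZgt⟩ := lip_approx ζ K C hζlip hC hζnonneg
  obtain ⟨⟨hud, hu2, hp2⟩, hweak⟩ := hu
  have hucont : Continuous u := hud.continuous
  have hMcont : Continuous M := hMreg.continuous
  have hζcont : Continuous ζ := hζlip.continuous
  have hZcont : ∀ k, Continuous (Z k) := fun k => (hZd k).continuous
  have hpm : Measurable (gradient u) := measurable_gradient_aux u
  have hqm : ∀ k, Measurable (gradient (Z k)) := fun k => measurable_gradient_aux _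
  have hqm0 : Measurable (gradient ζ) := measurable_gradient_aux _
  have hq0 : ∀ x, ‖gradient ζ x‖ ≤ K := fun x => by
    rw [gradient, LinearIsometryEquiv.norm_map]
    exact norm_fderiv_le_of_lipschitz ℝ hζlip
  set B : ℝ := Real.exp (α * C) with hB
  have hB0 : 0 < B := Real.exp_pos _
  have hK0 : (0:ℝ) ≤ K := K.2
  -- scalar bounds
  have hebd : ∀ z : ℝ, z ≤ C → Real.exp (α * z) ≤ B := fun z hz =>
    Real.exp_le_exp.2 (mul_le_mul_of_nonneg_left hz hα.le)
  have hg0 : ∀ z : ℝ, 0 ≤ z → 0 ≤ Real.exp (α * z) - 1 := fun z hz => by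
    have := Real.one_le_exp (mul_nonneg hα.le hz); linarith
  have hgB : ∀ z : ℝ, 0 ≤ z → z ≤ C → (Real.exp (α * z) - 1) ^ 2 ≤ B ^ 2 := fun z h1 h2 =>
    pow_le_pow_left₀ (hg0 z h1) (by linarith [hebd z h2]) 2
  have hgeB : ∀ z : ℝ, 0 ≤ z → z ≤ C →
      (Real.exp (α * z) - 1) * Real.exp (α * z) ≤ B ^ 2 := fun z h1 h2 => by
    have := hebd z h2
    have := hg0 z h1
    have := Real.exp_pos (α * z)
    nlinarith
  -- norm bound for gradient term
  have hcoef : ∀ (a z : ℝ) (q : EuclideanSpace ℝ (Fin n)), 0 ≤ z → z ≤ C → ‖q‖ ≤ K →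
      ‖(2 * a * (Real.exp (α * z) - 1) * α * Real.exp (α * z)) • q‖
        ≤ 2 * α * B ^ 2 * K * |a| := by
    intro a z q h1 h2 h3
    have e1 : 2 * a * (Real.exp (α * z) - 1) * α * Real.exp (α * z)
        = (2 * α * ((Real.exp (α * z) - 1) * Real.exp (α * z))) * a := by ring
    have e0 : 0 ≤ (Real.exp (α * z) - 1) * Real.exp (α * z) :=
      mul_nonneg (hg0 z h1) (Real.exp_pos _).le
    rw [e1, norm_smul, norm_mul, Real.norm_of_nonneg (by positivity), Real.norm_eq_abs]
    have e2 := hgeB z h1 h2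
    calc 2 * α * ((Real.exp (α * z) - 1) * Real.exp (α * z)) * |a| * ‖q‖
        ≤ 2 * α * B ^ 2 * |a| * K := by gcongr
      _ = _ := by ring
  have hsq : ∀ (z : ℝ) (p : EuclideanSpace ℝ (Fin n)), 0 ≤ z → z ≤ C →
      ‖(Real.exp (α * z) - 1) ^ 2 • p‖ ≤ B ^ 2 * ‖p‖ := by
    intro z p h1 h2
    rw [norm_smul, Real.norm_of_nonneg (sq_nonneg _)]
    exact mul_le_mul_of_nonneg_right (hgB z h1 h2) (norm_nonneg _)
  -- the gradient field of the test function
  let G : ℝ → ℝ → EuclideanSpace ℝ (Fin n) → EuclideanSpace ℝ (Fin n) →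
      EuclideanSpace ℝ (Fin n) := fun a z p q =>
    (Real.exp (α * z) - 1) ^ 2 • p +
      (2 * a * (Real.exp (α * z) - 1) * α * Real.exp (α * z)) • q
  have hGn : ∀ a z p q, 0 ≤ z → z ≤ C → ‖q‖ ≤ K →
      ‖G a z p q‖ ≤ B ^ 2 * ‖p‖ + 2 * α * B ^ 2 * K * |a| := fun a z p q h1 h2 h3 =>
    (norm_add_le _ _).trans (add_le_add (hsq z p h1 h2) (hcoef a z q h1 h2 h3))
  set D : ℝ := 2 * α * B ^ 2 * K with hD
  have hD0 : 0 ≤ D := by positivity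
  have hGm : ∀ (z : EuclideanSpace ℝ (Fin n) → ℝ)
      (q : EuclideanSpace ℝ (Fin n) → EuclideanSpace ℝ (Fin n)), Continuous z → Measurable q →
      Measurable (fun x => G (u x) (z x) (gradient u x) (q x)) := by
    intro z q hz hq
    have c1 : Continuous (fun x => (Real.exp (α * z x) - 1) ^ 2) := by fun_prop
    have c2 : Continuous (fun x => 2 * u x * (Real.exp (α * z x) - 1) * α * Real.exp (α * z x)) := by
      fun_prop
    exact (c1.measurable.smul hpm).add (c2.measurable.smul hq)
  have hgrad : ∀ k x, gradient (fun x => u x * (Real.exp (α * Z k x) - 1) ^ 2) x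
      = G (u x) (Z k x) (gradient u x) (gradient (Z k) x) := fun k x =>
    (hasGradientAt_test u (Z k) α x (hud x) (hZd k x)).gradient
  -- test functions are admissible
  have hmem : ∀ k, MemH1 M (fun x => u x * (Real.exp (α * Z k x) - 1) ^ 2) := by
    intro k
    refine ⟨fun x => (hasGradientAt_test u (Z k) α x (hud x) (hZd k x)).differentiableAt, ?_, ?_⟩
    · refine Integrable.mono' (hu2.const_mul (B ^ 4)) ?_ (Eventually.of_forall fun x => ?_)
      · have := hZcont k
        exact Continuous.aestronglyMeasurable (by fun_prop)
      · have h1 := hgB _ (hZ0 k x) (hZC k x)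
        have h2 := hMpos x
        rw [Real.norm_of_nonneg (by positivity)]
        calc (u x * (Real.exp (α * Z k x) - 1) ^ 2) ^ 2 * M x
            = ((Real.exp (α * Z k x) - 1) ^ 2) ^ 2 * (u x ^ 2 * M x) := by ring
          _ ≤ (B ^ 2) ^ 2 * (u x ^ 2 * M x) := by gcongr
          _ = _ := by ring
    · simp_rw [hgrad]
      refine Integrable.mono' ((hp2.const_mul (2 * (B ^ 2) ^ 2)).add (hu2.const_mul (2 * D ^ 2)))
        (((hGm _ _ (hZcont k) (hqm k)).norm.pow_const 2).mul
          hMcont.measurable).aestronglyMeasurable (Eventually.of_forall fun x => ?_)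
      have h1 := hGn (u x) (Z k x) (gradient u x) (gradient (Z k) x) (hZ0 k x) (hZC k x) (hZg k x)
      have h2 := hMpos x
      rw [Real.norm_of_nonneg (by positivity)]
      simp only [Pi.add_apply]
      calc _ ≤ (B ^ 2 * ‖gradient u x‖ + D * |u x|) ^ 2 * M x := by gcongr
        _ ≤ (2 * (B ^ 2 * ‖gradient u x‖) ^ 2 + 2 * (D * |u x|) ^ 2) * M x := by
            gcongr
            nlinarith [sq_nonneg (B ^ 2 * ‖gradient u x‖ - D * |u x|)]
        _ = _ := by rw [mul_pow D, sq_abs]; ring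
  -- domination for the gradient pairing
  have hpair : ∀ (a z : ℝ) (p q : EuclideanSpace ℝ (Fin n)) (m : ℝ), 0 ≤ z → z ≤ C → ‖q‖ ≤ K →
      0 < m → ‖⟪p, G a z p q⟫ * m‖ ≤ (B ^ 2 + D) * (‖p‖ ^ 2 * m) + D * (a ^ 2 * m) := by
    intro a z p q m h1 h2 h3 h4
    rw [norm_mul, Real.norm_of_nonneg h4.le]
    calc ‖⟪p, G a z p q⟫‖ * m ≤ (‖p‖ * (B ^ 2 * ‖p‖ + D * |a|)) * m := by
          gcongr
          exact (norm_inner_le_norm _ _).trans (by gcongr; exact hGn a z p q h1 h2 h3)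
      _ ≤ ((B ^ 2 + D) * ‖p‖ ^ 2 + D * a ^ 2) * m := by
          gcongr
          have h5 : ‖p‖ * |a| ≤ ‖p‖ ^ 2 + a ^ 2 := by
            rw [← sq_abs a]
            nlinarith [sq_nonneg (‖p‖ - |a|), sq_nonneg (‖p‖), sq_nonneg (|a|)]
          nlinarith [mul_le_mul_of_nonneg_left h5 hD0]
      _ = _ := by ring
  have hdomP : Integrable (fun x => (B ^ 2 + D) * (‖gradient u x‖ ^ 2 * M x)
      + D * (u x ^ 2 * M x)) := (hp2.const_mul _).add (hu2.const_mul _)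
  have hPm : ∀ (z : EuclideanSpace ℝ (Fin n) → ℝ)
      (q : EuclideanSpace ℝ (Fin n) → EuclideanSpace ℝ (Fin n)), Continuous z → Measurable q →
      AEStronglyMeasurable (fun x => ⟪gradient u x, G (u x) (z x) (gradient u x) (q x)⟫ * M x)
        volume := fun z q hz hq =>
    ((hpm.inner (hGm z q hz hq)).mul hMcont.measurable).aestronglyMeasurable
  -- the three limits
  have hL1 : Tendsto (fun k => ∫ x, u x * (u x * (Real.exp (α * Z k x) - 1) ^ 2) * M x) atTop
      (nhds (∫ x, u x * (u x * (Real.exp (α * ζ x) - 1) ^ 2) * M x)) := by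
    refine tendsto_integral_of_dominated_convergence (fun x => B ^ 2 * (u x ^ 2 * M x))
      (fun k => ?_) (hu2.const_mul _) (fun k => Eventually.of_forall fun x => ?_)
      (Eventually.of_forall fun x => ?_)
    · have := hZcont k
      exact Continuous.aestronglyMeasurable (by fun_prop)
    · have h1 := hgB _ (hZ0 k x) (hZC k x)
      have h2 := hMpos x
      have e : u x * (u x * (Real.exp (α * Z k x) - 1) ^ 2) * M x
        = (Real.exp (α * Z k x) - 1) ^ 2 * (u x ^ 2 * M x) := by ring
      rw [e, Real.norm_of_nonneg (by positivity)]
      gcongr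
    · have := hZt x
      have c : Continuous (fun z : ℝ => u x * (u x * (Real.exp (α * z) - 1) ^ 2) * M x) := by
        fun_prop
      exact (c.tendsto _).comp this
  have hL3 : Tendsto (fun k => ∫ x, f x * (u x * (Real.exp (α * Z k x) - 1) ^ 2) * M x) atTop
      (nhds (∫ x, f x * (u x * (Real.exp (α * ζ x) - 1) ^ 2) * M x)) := by
    refine tendsto_integral_of_dominated_convergence
      (fun x => B ^ 2 * (f x ^ 2 * M x) + B ^ 2 * (u x ^ 2 * M x))
      (fun k => ?_) ((hfL2.const_mul _).add (hu2.const_mul _))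
      (fun k => Eventually.of_forall fun x => ?_) (Eventually.of_forall fun x => ?_)
    · have := hZcont k
      refine (hfmeas.mul (Continuous.aestronglyMeasurable ?_)).mul hMcont.aestronglyMeasurable
      fun_prop
    · have h1 := hgB _ (hZ0 k x) (hZC k x)
      have h2 := hMpos x
      have e : f x * (u x * (Real.exp (α * Z k x) - 1) ^ 2) * M x
        = (Real.exp (α * Z k x) - 1) ^ 2 * ((f x * u x) * M x) := by ring
      rw [e, norm_mul, norm_mul, Real.norm_of_nonneg (sq_nonneg _), Real.norm_of_nonneg h2.le,
        ← mul_add, ← add_mul]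
      gcongr
      rw [Real.norm_eq_abs, abs_le]
      constructor <;> nlinarith [sq_nonneg (f x + u x), sq_nonneg (f x - u x)]
    · have := hZt x
      have c : Continuous (fun z : ℝ => f x * (u x * (Real.exp (α * z) - 1) ^ 2) * M x) := by
        fun_prop
      exact (c.tendsto _).comp this
  have hL2 : Tendsto (fun k => ∫ x, ⟪gradient u x,
      G (u x) (Z k x) (gradient u x) (gradient (Z k) x)⟫ * M x) atTop
      (nhds (∫ x, ⟪gradient u x, G (u x) (ζ x) (gradient u x) (gradient ζ x)⟫ * M x)) := by
    refine tendsto_integral_of_dominated_convergence _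
      (fun k => hPm _ _ (hZcont k) (hqm k)) hdomP
      (fun k => Eventually.of_forall fun x =>
        hpair _ _ _ _ _ (hZ0 k x) (hZC k x) (hZg k x) (hMpos x)) ?_
    filter_upwards [hZgt] with x hx
    have := (hZt x).prodMk_nhds hx
    have c : Continuous (fun w : ℝ × EuclideanSpace ℝ (Fin n) =>
        ⟪gradient u x, G (u x) w.1 (gradient u x) w.2⟫ * M x) := by
      simp only [G]
      fun_prop
    have h9 := (c.tendsto (ζ x, gradient ζ x)).comp this
    simp only [Function.comp_def] at h9
    exact h9
  have hid : (∫ x, u x * (u x * (Real.exp (α * ζ x) - 1) ^ 2) * M x)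
      + t * (∫ x, ⟪gradient u x, G (u x) (ζ x) (gradient u x) (gradient ζ x)⟫ * M x)
      = ∫ x, f x * (u x * (Real.exp (α * ζ x) - 1) ^ 2) * M x := by
    refine tendsto_nhds_unique (hL1.add (hL2.const_mul t)) ?_
    refine hL3.congr fun k => ?_
    have := hweak _ (hmem k)
    simp_rw [hgrad] at this
    exact this.symm
  have hzero : (∫ x, f x * (u x * (Real.exp (α * ζ x) - 1) ^ 2) * M x) = 0 := by
    rw [← integral_zero (EuclideanSpace ℝ (Fin n)) ℝ (μ := volume)]
    congr 1
    ext x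
    by_cases hx : x ∈ E
    · simp [hζE x hx]
    · have : f x = 0 := by
        by_contra h
        exact hx (hsupp h)
      simp [this]
  have hPint : Integrable
      (fun x => ⟪gradient u x, G (u x) (ζ x) (gradient u x) (gradient ζ x)⟫ * M x) :=
    Integrable.mono' hdomP (hPm _ _ hζcont hqm0) (Eventually.of_forall fun x =>
      hpair _ _ _ _ _ (hζnonneg x) (hC x) (hq0 x) (hMpos x))
  have hRint : Integrable (fun x => u x ^ 2 * ‖gradient ζ x‖ ^ 2
          * Real.exp (2 * α * ζ x) * M x) := by
    refine Integrable.mono' (hu2.const_mul ((K:ℝ) ^ 2 * B ^ 2)) ?_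
      (Eventually.of_forall fun x => ?_)
    · have c : Continuous (fun x => Real.exp (2 * α * ζ x)) := by fun_prop
      exact ((((hucont.measurable.pow_const 2).mul (hqm0.norm.pow_const 2)).mul
        c.measurable).mul hMcont.measurable).aestronglyMeasurable
    · have h2 := hMpos x
      have e : Real.exp (2 * α * ζ x) = Real.exp (α * ζ x) ^ 2 := by
        rw [← Real.exp_nat_mul]; congr 1; push_cast; ring
      rw [Real.norm_of_nonneg (by positivity), e]
      have h3 := hebd _ (hC x)
      have h4 := hq0 x
      calc _ = ‖gradient ζ x‖ ^ 2 * Real.exp (α * ζ x) ^ 2 * (u x ^ 2 * M x) := by ring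
        _ ≤ _ := by gcongr
  have hlow : -(α ^ 2 * ∫ x, u x ^ 2 * ‖gradient ζ x‖ ^ 2 * Real.exp (2 * α * ζ x) * M x)
      ≤ ∫ x, ⟪gradient u x, G (u x) (ζ x) (gradient u x) (gradient ζ x)⟫ * M x := by
    rw [← integral_const_mul, ← integral_neg]
    refine integral_mono (hRint.const_mul _).neg hPint fun x => ?_
    have h2 := hMpos x
    have e : Real.exp (2 * α * ζ x) = Real.exp (α * ζ x) ^ 2 := by
      rw [← Real.exp_nat_mul]; congr 1; push_cast; ring
    simp only [G, inner_add_right, inner_smul_right, e, real_inner_self_eq_norm_sq]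
    have key : 0 ≤ ‖(Real.exp (α * ζ x) - 1) • gradient u x
        + (u x * α * Real.exp (α * ζ x)) • gradient ζ x‖ ^ 2 := sq_nonneg _
    rw [norm_add_sq_real, norm_smul, norm_smul, mul_pow, mul_pow, Real.norm_eq_abs,
      Real.norm_eq_abs, sq_abs, sq_abs, inner_smul_left, inner_smul_right] at key
    simp only [conj_trivial] at key
    have := mul_nonneg key h2.le
    nlinarith [this]
  have e1 : (∫ x, (Real.exp (α * ζ x) - 1) ^ 2 * u x ^ 2 * M x)
      = ∫ x, u x * (u x * (Real.exp (α * ζ x) - 1) ^ 2) * M x := by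
    congr 1
    ext x
    ring
  rw [e1]
  rw [hzero] at hid
  nlinarith [mul_le_mul_of_nonneg_left hlow ht.le]
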